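/- Let p₁₂(x) = x¹² − 4x¹¹ + 10x¹⁰ − 44x⁹ + 174x⁸ − 422x⁷ + 618x⁶ − 512x⁵ + 170x⁴ + 56x³ − 58x² + 6x + 9, which is irreducible over ℚ, and let L := ℚ[x]/(p₁₂) be the corresponding degree-12 number field with ring of integers 𝒪_L. Let R := 𝒪_L[1/2] (the localization of 𝒪_L away from 2). Then the quotient of the unit group Rˣ by its subgroup of squares {u² : u ∈ Rˣ} is isomorphic as a group to (ℤ/2ℤ)⁹. -/

import Mathlib

open Polynomial NumberField

/-- The degree-12 polynomial cutting out the field `L` of the Faltings–Serre argument. -/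
noncomputable def p12 : Polynomial ℚ :=
  X ^ 12 - C 4 * X ^ 11 + C 10 * X ^ 10 - C 44 * X ^ 9 + C 174 * X ^ 8 - C 422 * X ^ 7
    + C 618 * X ^ 6 - C 512 * X ^ 5 + C 170 * X ^ 4 + C 56 * X ^ 3 - C 58 * X ^ 2
    + C 6 * X + C 9

open IsDedekindDomain

theorem index_range_nsmul_two_pi (n : ℕ) :
    (nsmulAddMonoidHom 2 : (Fin n → ℤ) →+ (Fin n → ℤ)).range.index = 2 ^ n := by
  let φ : (Fin n → ℤ) →+ (Fin n → ZMod 2) := (Int.castAddHom (ZMod 2)).compLeft (Fin n)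
  have hφ : Function.Surjective φ := fun y ↦
    ⟨fun i ↦ ((y i).val : ℤ), by ext i; simp [φ]⟩
  have hk : (nsmulAddMonoidHom 2 : (Fin n → ℤ) →+ (Fin n → ℤ)).range = φ.ker := by
    ext x
    simp only [AddMonoidHom.mem_range, AddMonoidHom.mem_ker]
    constructor
    · rintro ⟨y, rfl⟩
      ext i
      have : (2 : ZMod 2) = 0 := rfl
      simp [φ, this]
    · intro h
      have h' (i : Fin n) : (2 : ℤ) ∣ x i :=
        (ZMod.intCast_zmod_eq_zero_iff_dvd _ 2).mp (congrFun h i)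
      choose y hy using h'
      exact ⟨y, by ext i; simp [hy]⟩
  rw [hk, AddSubgroup.index_ker, AddMonoidHom.range_eq_top.mpr hφ, AddSubgroup.card_top]
  simp [Nat.card_eq_fintype_card]

theorem index_range_nsmul_two (A : Type*) [AddCommGroup A] [Module.Finite ℤ A] :
    (nsmulAddMonoidHom 2 : A →+ A).range.index =
      2 ^ Module.finrank ℤ A * Nat.card (nsmulAddMonoidHom 2 : A →+ A).ker := by
  have : AddGroup.FG A := Module.Finite.iff_addGroup_fg.mp inferInstance
  obtain ⟨n, D, _, hD, ⟨f⟩⟩ : ∃ (n : ℕ) (D : Type) (_ : AddCommGroup D) (_ : Finite D),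
      Nonempty (A ≃+ (Fin n → ℤ) × D) := by
    classical
    obtain ⟨n, ι, _, p, hp, e, ⟨f⟩⟩ := AddCommGroup.equiv_free_prod_directSum_zmod A
    have : ∀ i, NeZero (p i ^ e i) := fun i ↦ ⟨pow_ne_zero _ (hp i).ne_zero⟩
    exact ⟨n, ∀ i, ZMod (p i ^ e i), inferInstance, inferInstance,
      ⟨f.trans (Finsupp.addEquivFunOnFinite.prodCongr (DirectSum.addEquivProd _))⟩⟩
  have hrank : Module.finrank ℤ A = n := by
    rw [f.toIntLinearEquiv.finrank_eq]
    have hle : LinearMap.ker (LinearMap.fst ℤ (Fin n → ℤ) D) ≤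
        Submodule.torsion ℤ ((Fin n → ℤ) × D) := by
      rintro ⟨a, d⟩ h
      obtain rfl : a = 0 := h
      rw [Submodule.mem_torsion_iff]
      refine ⟨⟨(Nat.card D : ℤ), by simp [Nat.card_pos.ne']⟩, ?_⟩
      ext
      · simp [Submonoid.smul_def]
      · simp [Submonoid.smul_def]
    have h := finrank_quotient_eq_of_le_torsion hle
    rw [← h, (LinearMap.quotKerEquivOfSurjective _ LinearMap.fst_surjective).finrank_eq]
    simp
  have hrange : (nsmulAddMonoidHom 2 : A →+ A).range.map (f : A →+ (Fin n → ℤ) × D) =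
      (nsmulAddMonoidHom 2 : (Fin n → ℤ) →+ (Fin n → ℤ)).range.prod
        (nsmulAddMonoidHom 2 : D →+ D).range := by
    ext ⟨a, d⟩
    constructor
    · rintro ⟨_, ⟨x, rfl⟩, hx⟩
      have hx : 2 • f x = (a, d) := by simpa using hx
      exact ⟨⟨(f x).1, congrArg Prod.fst hx⟩, ⟨(f x).2, congrArg Prod.snd hx⟩⟩
    · rintro ⟨⟨x, hx⟩, ⟨y, hy⟩⟩
      exact ⟨_, ⟨f.symm (x, y), rfl⟩, by
        rw [AddMonoidHom.coe_coe, nsmulAddMonoidHom_apply, map_nsmul, AddEquiv.apply_symm_apply]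
        exact Prod.ext hx hy⟩
  have hker : Nat.card (nsmulAddMonoidHom 2 : A →+ A).ker =
      Nat.card (nsmulAddMonoidHom 2 : D →+ D).ker := by
    refine Nat.card_congr ⟨fun x ↦ ⟨(f x).2, ?_⟩, fun d ↦ ⟨f.symm (0, d), ?_⟩, fun x ↦ ?_,
      fun d ↦ ?_⟩
    · have h : 2 • (x : A) = 0 := x.2
      change 2 • (f x).2 = 0
      rw [← Prod.smul_snd, ← map_nsmul, h, map_zero, Prod.snd_zero]
    · have h : 2 • (d : D) = 0 := d.2
      change 2 • f.symm (0, (d : D)) = 0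
      rw [← map_nsmul, Prod.smul_mk, h, smul_zero]
      exact map_zero _
    · have h : 2 • (x : A) = 0 := x.2
      have h1 : (f x).1 = 0 := by
        have : 2 • (f x).1 = 0 := by rw [← Prod.smul_fst, ← map_nsmul, h, map_zero, Prod.fst_zero]
        exact (smul_eq_zero_iff_right two_ne_zero).mp this
      ext
      change f.symm (0, (f x).2) = x
      rw [← h1]
      exact f.symm_apply_apply _
    · ext
      simp
  rw [← AddSubgroup.index_map_equiv _ f, hrange, AddSubgroup.index_prod, index_range_nsmul_two_pi,
    AddSubgroup.index_range, hrank, hker]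

theorem nonempty_mulEquiv_of_card (Q : Type*) [CommGroup Q] (n : ℕ) (h2 : ∀ x : Q, x ^ 2 = 1)
    (hc : Nat.card Q = 2 ^ n) : Nonempty (Q ≃* Multiplicative (Fin n → ZMod 2)) := by
  let : Module (ZMod 2) (Additive Q) := AddCommGroup.zmodModule fun x ↦ h2 x.toMul
  have : Finite (Additive Q) := Nat.finite_of_card_ne_zero (α := Q) (by simp [hc])
  have hr : Module.finrank (ZMod 2) (Additive Q) = n := by
    have := Module.natCard_eq_pow_finrank (K := ZMod 2) (V := Additive Q)
    rw [Nat.card_zmod] at this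
    exact Nat.pow_right_injective le_rfl (this.symm.trans hc)
  exact ⟨AddEquiv.toMultiplicativeRight
    (LinearEquiv.ofFinrankEq (Additive Q) (Fin n → ZMod 2)
      (by rw [hr, Module.finrank_fin_fun])).toAddEquiv⟩

theorem nonempty_quotient_range_pow_two_mulEquiv (G : Type*) [CommGroup G]
    [Module.Finite ℤ (Additive G)] (hG : Nat.card (powMonoidHom 2 : G →* G).ker = 2) :
    Nonempty (G ⧸ (powMonoidHom 2 : G →* G).range ≃*
      Multiplicative (Fin (Module.finrank ℤ (Additive G) + 1) → ZMod 2)) := by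
  refine nonempty_mulEquiv_of_card _ _ ?_ ?_
  · rintro ⟨x⟩
    exact (QuotientGroup.eq_one_iff (x ^ 2)).mpr ⟨x, rfl⟩
  · have := index_range_nsmul_two (Additive G)
    rw [pow_succ]
    exact this.trans (congrArg _ hG)

theorem injective_of_isLocalization_away {K : Type*} [Field K] {R : Type*} [CommRing R] (a : 𝓞 K)
    (φ : R →+* K) [Algebra (𝓞 K) R] [IsLocalization.Away a R]
    (hφ : ∀ x, φ (algebraMap (𝓞 K) R x) = x) : Function.Injective φ := by
  rw [injective_iff_map_eq_zero]
  intro y hy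
  obtain ⟨n, x, hx⟩ := IsLocalization.Away.surj a y
  have hu := IsLocalization.Away.algebraMap_isUnit (S := R) a
  have : x = 0 := by
    have := congrArg φ hx
    rw [map_mul, hy, zero_mul, hφ] at this
    exact_mod_cast this.symm
  rw [this, map_zero] at hx
  exact (hu.pow n).mul_left_eq_zero.mp hx

section SUnits

variable {K : Type*} [Field K] [NumberField K] {R : Type*} [CommRing R] (a : 𝓞 K) (φ : R →+* K)

/-- The vector of additive valuations of a unit of `R ⊆ K` at the primes dividing `a`. -/
noncomputable def valuationVector :
    Additive Rˣ →ₗ[ℤ] ({v : HeightOneSpectrum (𝓞 K) // a ∈ v.asIdeal} → ℤ) :=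
  AddMonoidHom.toIntLinearMap
    { toFun x v := (v.1.valuationOfNeZero (K := K) (Units.map φ x.toMul)).toAdd
      map_zero' := by ext; simp
      map_add' x y := by ext; simp }

theorem valuationVector_eq_zero_iff (x : Additive Rˣ) :
    valuationVector a φ x = 0 ↔
      ∀ v : HeightOneSpectrum (𝓞 K), a ∈ v.asIdeal → v.valuation K (φ (x.toMul : R)) = 1 := by
  rw [funext_iff, Subtype.forall]
  refine forall₂_congr fun v _ ↦ ?_
  change v.valuationOfNeZero (K := K) (Units.map φ x.toMul) = 1 ↔ _
  rw [← WithZero.coe_inj, HeightOneSpectrum.valuationOfNeZero_eq]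
  rfl

theorem exists_pow_eq_span_singleton (v : HeightOneSpectrum (𝓞 K)) :
    ∃ (n : ℕ) (z : 𝓞 K), n ≠ 0 ∧ v.asIdeal ^ n = Ideal.span {z} := by
  have h0 : v.asIdeal ∈ nonZeroDivisors (Ideal (𝓞 K)) := mem_nonZeroDivisors_of_ne_zero v.ne_bot
  set c : ClassGroup (𝓞 K) := ClassGroup.mk0 ⟨v.asIdeal, h0⟩ with hc
  refine ⟨Fintype.card (ClassGroup (𝓞 K)), ?_⟩
  generalize hn : Fintype.card (ClassGroup (𝓞 K)) = n
  have h1 : ClassGroup.mk0 ⟨v.asIdeal ^ n, pow_mem h0 n⟩ = 1 := by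
    have h2 : c ^ n = 1 := hn ▸ pow_card_eq_one
    rw [← h2, hc, ← map_pow]
    rfl
  obtain ⟨z, hz⟩ := (ClassGroup.mk0_eq_one_iff (pow_mem h0 n)).mp h1
  exact ⟨z, hn ▸ Fintype.card_ne_zero, hz⟩

variable [Algebra (𝓞 K) R] [IsLocalization.Away a R]

theorem valuation_unit_eq_one
    (hφ : ∀ x, φ (algebraMap (𝓞 K) R x) = x) (x : Rˣ) (v : HeightOneSpectrum (𝓞 K))
    (hv : a ∉ v.asIdeal) :
    v.valuation K (φ (x : R)) = 1 := by
  have hle (y : R) : v.valuation K (φ y) ≤ 1 := by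
    obtain ⟨n, z, hz⟩ := IsLocalization.Away.surj a y
    have h1 := congrArg (v.valuation K) (congrArg φ hz)
    rw [map_mul, map_pow, hφ, hφ, map_mul, map_pow,
      v.valuation_eq_one_iff_notMem.mpr hv, one_pow, mul_one] at h1
    rw [h1]
    exact v.valuation_le_one z
  refine le_antisymm (hle _) ?_
  have h : v.valuation K (φ (x : R)) * v.valuation K (φ ((x⁻¹ : Rˣ) : R)) = 1 := by
    rw [← map_mul, ← map_mul, Units.mul_inv, map_one, map_one]
  rw [← h]
  exact mul_le_of_le_one_right' (hle _)

/-- The units of `𝓞 K` as the kernel of the valuation vector. -/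
theorem range_unitsMap_eq_ker_valuationVector
    (hφ : ∀ x, φ (algebraMap (𝓞 K) R x) = x) :
    LinearMap.range (MonoidHom.toAdditive
      (Units.map (algebraMap (𝓞 K) R : 𝓞 K →* R))).toIntLinearMap =
      LinearMap.ker (valuationVector a φ) := by
  ext x
  rw [LinearMap.mem_ker, valuationVector_eq_zero_iff]
  constructor
  · rintro ⟨u, rfl⟩ v -
    have := HeightOneSpectrum.valuation_of_unit_eq (K := K) v u.toMul
    rw [← WithZero.coe_inj, HeightOneSpectrum.valuationOfNeZero_eq] at this
    refine Eq.trans ?_ this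
    exact congrArg _ (hφ _)
  · intro h
    have hall (y : Rˣ) (hy : ∀ v : HeightOneSpectrum (𝓞 K), v.valuation K (φ (y : R)) = 1) :
        ∃ z : 𝓞 K, algebraMap (𝓞 K) R z = y := by
      obtain ⟨z, hz⟩ := HeightOneSpectrum.mem_integers_of_valuation_le_one (R := 𝓞 K) K
        (φ (y : R)) fun v ↦ (hy v).le
      exact ⟨z, injective_of_isLocalization_away a φ hφ ((hφ z).trans hz)⟩
    have h' (v : HeightOneSpectrum (𝓞 K)) : v.valuation K (φ (x.toMul : R)) = 1 := by
      by_cases hv : a ∈ v.asIdeal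
      · exact h v hv
      · exact valuation_unit_eq_one a φ hφ _ v hv
    obtain ⟨z, hz⟩ := hall x.toMul h'
    obtain ⟨w, hw⟩ := hall x.toMul⁻¹ fun v ↦ by
      have := congrArg (v.valuation K) (congrArg φ (x.toMul).mul_inv)
      rwa [map_mul, map_mul, h' v, one_mul, map_one, map_one] at this
    have hinj : Function.Injective (algebraMap (𝓞 K) R) := fun r s hrs ↦ by
      have := congrArg φ hrs
      rw [hφ, hφ] at this
      exact_mod_cast this
    have hzw : z * w = 1 := hinj (by rw [map_mul, hz, hw, Units.mul_inv, map_one])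
    refine ⟨Additive.ofMul ⟨z, w, hzw, (mul_comm _ _).trans hzw⟩, ?_⟩
    refine congrArg Additive.ofMul (Units.ext hz)

theorem exists_valuationVector_eq_single
    (hφ : ∀ x, φ (algebraMap (𝓞 K) R x) = x)
    [DecidableEq {v : HeightOneSpectrum (𝓞 K) // a ∈ v.asIdeal}]
    (v : {v : HeightOneSpectrum (𝓞 K) // a ∈ v.asIdeal}) :
    ∃ (x : Additive Rˣ) (n : ℤ), n ≠ 0 ∧ valuationVector a φ x = Pi.single v n := by
  obtain ⟨n, z, hn, hz⟩ := exists_pow_eq_span_singleton v.1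
  have hmem (w : HeightOneSpectrum (𝓞 K)) : z ∈ w.asIdeal ↔ w = v := by
    rw [← Ideal.span_singleton_le_iff_mem, ← hz, w.isPrime.pow_le_iff hn]
    constructor
    · intro h
      exact (HeightOneSpectrum.ext (v.1.isMaximal.eq_of_le w.isPrime.ne_top h)).symm
    · rintro rfl
      exact le_rfl
  obtain ⟨u, hu⟩ : IsUnit (algebraMap (𝓞 K) R z) := by
    rw [IsLocalization.Away.algebraMap_isUnit_iff a]
    exact ⟨n, by rw [← Ideal.mem_span_singleton, ← hz]; exact Ideal.pow_mem_pow v.2 n⟩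
  have hval (w : HeightOneSpectrum (𝓞 K)) :
      w.valuationOfNeZero (K := K) (Units.map φ u) = 1 ↔ w ≠ v := by
    have : ((Units.map φ u : Kˣ) : K) = algebraMap (𝓞 K) K z := (congrArg φ hu).trans (hφ z)
    rw [← WithZero.coe_inj, HeightOneSpectrum.valuationOfNeZero_eq, ne_eq, ← hmem,
      ← w.valuation_eq_one_iff_notMem (K := K), this]
    rfl
  refine ⟨Additive.ofMul u, valuationVector a φ (Additive.ofMul u) v, ?_, ?_⟩
  · intro h
    exact (hval v).mp h rfl
  · ext w
    by_cases hw : w = v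
    · rw [hw, Pi.single_eq_same]
    · rw [Pi.single_eq_of_ne hw]
      exact (hval w).mpr fun h ↦ hw (Subtype.ext h)

theorem finrank_range_valuationVector
    (hφ : ∀ x, φ (algebraMap (𝓞 K) R x) = x)
    [Finite {v : HeightOneSpectrum (𝓞 K) // a ∈ v.asIdeal}] :
    Module.finrank ℤ (LinearMap.range (valuationVector a φ)) =
      Nat.card {v : HeightOneSpectrum (𝓞 K) // a ∈ v.asIdeal} := by
  classical
  have := Fintype.ofFinite {v : HeightOneSpectrum (𝓞 K) // a ∈ v.asIdeal}
  refine le_antisymm ?_ ?_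
  · refine (Submodule.finrank_le _).trans ?_
    rw [Module.finrank_fintype_fun_eq_card, Nat.card_eq_fintype_card]
  · choose x n hn hx using exists_valuationVector_eq_single a φ hφ
    have hli : LinearIndependent ℤ (fun v ↦ valuationVector a φ (x v)) := by
      rw [Fintype.linearIndependent_iff]
      intro g hg v
      have := congrFun hg v
      simp only [hx, Finset.sum_apply, Pi.smul_apply, Pi.single_apply, smul_eq_mul, mul_ite,
        mul_zero, Finset.sum_ite_eq, Finset.mem_univ, if_true, Pi.zero_apply] at this
      exact (mul_eq_zero.mp this).resolve_right (hn v)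
    have hli' : LinearIndependent ℤ (fun v ↦ (⟨valuationVector a φ (x v), x v, rfl⟩ :
        LinearMap.range (valuationVector a φ))) :=
      LinearIndependent.of_comp (LinearMap.range (valuationVector a φ)).subtype hli
    rw [Nat.card_eq_fintype_card]
    exact hli'.fintype_card_le_finrank

theorem finite_and_finrank_units_of_isLocalization_away
    (hφ : ∀ x, φ (algebraMap (𝓞 K) R x) = x)
    [Finite {v : HeightOneSpectrum (𝓞 K) // a ∈ v.asIdeal}] :
    Module.Finite ℤ (Additive Rˣ) ∧ Module.finrank ℤ (Additive Rˣ) =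
      Units.rank K + Nat.card {v : HeightOneSpectrum (𝓞 K) // a ∈ v.asIdeal} := by
  have hker := range_unitsMap_eq_ker_valuationVector a φ hφ
  have hN : IsNoetherian ℤ (Additive Rˣ) := isNoetherian_of_range_eq_ker _ _ hker
  refine ⟨inferInstance, ?_⟩
  have hinj : Function.Injective (MonoidHom.toAdditive
      (Units.map (algebraMap (𝓞 K) R : 𝓞 K →* R))).toIntLinearMap := by
    refine Units.map_injective (f := (algebraMap (𝓞 K) R : 𝓞 K →* R)) fun r s hrs ↦ ?_
    have := congrArg φ hrs
    exact RingOfIntegers.ext (((hφ r).symm.trans this).trans (hφ s))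
  rw [← Submodule.finrank_quotient_add_finrank (LinearMap.ker (valuationVector a φ)),
    (LinearMap.quotKerEquivRange _).finrank_eq, finrank_range_valuationVector a φ hφ, ← hker,
    LinearMap.finrank_range_of_inj hinj, Units.finrank_eq, add_comm]

end SUnits

theorem finite_and_finrank_units_localization_away (K : Type*) [Field K] [NumberField K] {a : 𝓞 K}
    (ha : a ≠ 0) [Finite {v : HeightOneSpectrum (𝓞 K) // a ∈ v.asIdeal}] :
    Module.Finite ℤ (Additive (Localization.Away a)ˣ) ∧
      Module.finrank ℤ (Additive (Localization.Away a)ˣ) =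
        Units.rank K + Nat.card {v : HeightOneSpectrum (𝓞 K) // a ∈ v.asIdeal} := by
  have hu : IsUnit (algebraMap (𝓞 K) K a) :=
    ((map_ne_zero_iff _ (FaithfulSMul.algebraMap_injective (𝓞 K) K)).mpr ha).isUnit
  exact finite_and_finrank_units_of_isLocalization_away a (IsLocalization.Away.lift a hu)
    fun x ↦ IsLocalization.Away.lift_eq a hu x

theorem card_ker_powMonoidHom_two_units {R : Type*} [CommRing R] [IsDomain R] [CharZero R] :
    Nat.card (powMonoidHom 2 : Rˣ →* Rˣ).ker = 2 := by
  have : ((powMonoidHom 2 : Rˣ →* Rˣ).ker : Set Rˣ) = {1, -1} := by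
    ext x
    rw [SetLike.mem_coe, MonoidHom.mem_ker, powMonoidHom_apply, Set.mem_insert_iff,
      Set.mem_singleton_iff, Units.ext_iff, Units.ext_iff, Units.ext_iff, sq]
    exact mul_self_eq_one_iff
  have hne : (1 : Rˣ) ≠ -1 := fun h ↦ by
    have : (1 : R) = -1 := congrArg Units.val h
    exact one_ne_zero (self_eq_neg.mp this)
  change Nat.card ((powMonoidHom 2 : Rˣ →* Rˣ).ker : Set Rˣ) = 2
  rw [this, Nat.card_coe_set_eq, Set.ncard_pair hne]

theorem irreducible_of_natDegree_eq_two_or_three_of_ne_zero {F : Type*} [Field F] {p : F[X]}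
    (hp : p.natDegree = 2 ∨ p.natDegree = 3) (h : ∀ x, p.eval x ≠ 0) : Irreducible p := by
  rw [irreducible_iff_roots_eq_zero_of_degree_le_three (by omega) (by omega)]
  refine Multiset.eq_zero_of_forall_notMem fun x hx ↦ h x (isRoot_of_mem_roots hx)

theorem exists_int_eq_of_cubic {q : ℚ} {a b c : ℤ} (h : q ^ 3 + a * q ^ 2 + b * q + c = 0) :
    ∃ n : ℤ, (n : ℚ) = q := by
  refine IsIntegrallyClosed.isIntegral_iff.mp
    (⟨X ^ 3 + C a * X ^ 2 + C b * X + C c, by monicity!, ?_⟩ : IsIntegral ℤ q)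
  simpa only [eval₂_add, eval₂_mul, eval₂_X_pow, eval₂_X, eval₂_C, algebraMap_int_eq,
    Int.coe_castRingHom] using h

theorem natDegree_minpoly_eq_three {F : Type*} [Field F] [CharZero F] {b : F}
    (hb : b ^ 3 - b ^ 2 - 4 * b + 6 = 0) : (minpoly ℚ b).natDegree = 3 := by
  have hd : (X ^ 3 - X ^ 2 - C 4 * X + C 6 : ℚ[X]).natDegree = 3 := by compute_degree!
  have hm : (X ^ 3 - X ^ 2 - C 4 * X + C 6 : ℚ[X]).Monic := by monicity!
  have hi : Irreducible (X ^ 3 - X ^ 2 - C 4 * X + C 6 : ℚ[X]) := by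
    refine irreducible_of_natDegree_eq_two_or_three_of_ne_zero (.inr hd) fun q hq ↦ ?_
    simp only [eval_add, eval_sub, eval_pow, eval_X, eval_mul, eval_C] at hq
    obtain ⟨n, rfl⟩ := exists_int_eq_of_cubic (q := q) (a := -1) (b := -4) (c := 6)
      (by push_cast; linear_combination hq)
    have h5 : ((n ^ 3 - n ^ 2 - 4 * n + 6 : ℤ) : ZMod 5) = 0 := by
      rw [show n ^ 3 - n ^ 2 - 4 * n + 6 = 0 by exact_mod_cast hq, Int.cast_zero]
    push_cast at h5
    generalize (n : ZMod 5) = m at h5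
    revert h5 m
    decide
  rw [← minpoly.eq_of_irreducible_of_monic hi (by simpa [map_ofNat] using hb) hm, hd]

theorem not_isIntegral_of_cubic {F : Type*} [Field F] [CharZero F] {w : F}
    (hw : 2 * w ^ 3 - 13 * w ^ 2 + 12 * w - 4 = 0) : ¬ IsIntegral ℤ w := by
  intro hint
  have hd : (X ^ 3 - C (13 / 2) * X ^ 2 + C 6 * X - C 2 : ℚ[X]).natDegree = 3 := by
    compute_degree!
  have hm : (X ^ 3 - C (13 / 2) * X ^ 2 + C 6 * X - C 2 : ℚ[X]).Monic := by monicity!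
  have hi : Irreducible (X ^ 3 - C (13 / 2) * X ^ 2 + C 6 * X - C 2 : ℚ[X]) := by
    refine irreducible_of_natDegree_eq_two_or_three_of_ne_zero (.inr hd) fun q hq ↦ ?_
    simp only [eval_add, eval_sub, eval_pow, eval_X, eval_mul, eval_C] at hq
    obtain ⟨n, hn⟩ := exists_int_eq_of_cubic (q := 2 * q) (a := -13) (b := 24) (c := -16)
      (by push_cast; linear_combination 8 * hq)
    have h5 : ((n ^ 3 - 13 * n ^ 2 + 24 * n - 16 : ℤ) : ZMod 5) = 0 := by
      have : (n ^ 3 - 13 * n ^ 2 + 24 * n - 16 : ℚ) = 0 := by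
        rw [hn]
        linear_combination 8 * hq
      rw [show n ^ 3 - 13 * n ^ 2 + 24 * n - 16 = 0 by exact_mod_cast this, Int.cast_zero]
    push_cast at h5
    generalize (n : ZMod 5) = m at h5
    revert h5 m
    decide
  have hmin := minpoly.eq_of_irreducible_of_monic hi (x := w) (by
    simp only [map_add, map_sub, map_mul, map_pow, aeval_X, aeval_C, map_div₀, map_ofNat]
    linear_combination hw / 2) hm
  have hc := congrArg (fun p ↦ p.coeff 2)
    (hmin.trans (minpoly.isIntegrallyClosed_eq_field_fractions' ℚ hint))
  simp only [coeff_map] at hc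
  generalize (minpoly ℤ w).coeff 2 = m at hc
  have hc : -(13 / 2 : ℚ) = m := by
    rw [← eq_intCast (algebraMap ℤ ℚ), ← hc]
    simp
  have : (-13 : ℤ) = 2 * m := by
    exact_mod_cast (by linear_combination 2 * hc : (-13 : ℚ) = 2 * m)
  omega

theorem natDegree_minpoly_sq {k F : Type*} [Field k] [Field F] [Algebra k F] {s : F} (d : k)
    (hs : s ^ 2 = algebraMap k F d) (h : ∀ x : k, x ^ 2 ≠ d) : (minpoly k s).natDegree = 2 := by
  have hd : (X ^ 2 - C d : k[X]).natDegree = 2 := natDegree_X_pow_sub_C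
  have hi : Irreducible (X ^ 2 - C d : k[X]) := by
    refine irreducible_of_natDegree_eq_two_or_three_of_ne_zero (.inl hd) fun x hx ↦ ?_
    simp only [eval_sub, eval_pow, eval_X, eval_C, sub_eq_zero] at hx
    exact h x hx
  rw [← minpoly.eq_of_irreducible_of_monic hi (by simp [hs]) (monic_X_pow_sub_C d two_ne_zero), hd]

theorem sq_ne_sixty_one (x : ℚ) : x ^ 2 ≠ 61 := by
  intro h
  have h2 : IsSquare (61 : ℚ) := ⟨x, by rw [← h, sq]⟩
  have h3 : IsSquare (61 : ℕ) := by exact_mod_cast h2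
  exact (Nat.prime_iff.mp (by norm_num : Nat.Prime 61)).irreducible.not_isSquare h3

theorem four_dvd_finrank {F : Type*} [Field F] [CharZero F] [FiniteDimensional ℚ F] {i s : F}
    (hi : i ^ 2 = -1) (hs : s ^ 2 = 61) : 4 ∣ Module.finrank ℚ F := by
  have hint : IsIntegral ℚ i := IsIntegral.of_finite ℚ i
  have h2 : Module.finrank ℚ (IntermediateField.adjoin ℚ {i}) = 2 := by
    rw [IntermediateField.adjoin.finrank hint]
    refine natDegree_minpoly_sq (-1) (by simpa using hi) fun x hx ↦ ?_
    nlinarith [sq_nonneg x]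
  have hform (x : F) (hx : x ∈ IntermediateField.adjoin ℚ {i}) : ∃ a b : ℚ, x = a + b * i := by
    rw [← IntermediateField.mem_toSubalgebra,
      IntermediateField.adjoin_simple_toSubalgebra_of_isAlgebraic hint.isAlgebraic] at hx
    induction hx using Algebra.adjoin_induction with
    | mem x hx => exact ⟨0, 1, by rw [Set.mem_singleton_iff.mp hx]; simp⟩
    | algebraMap r => exact ⟨r, 0, by simp⟩
    | add x y _ _ hx hy =>
      obtain ⟨a, b, rfl⟩ := hx
      obtain ⟨c, d, rfl⟩ := hy
      exact ⟨a + c, b + d, by push_cast; ring⟩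
    | mul x y _ _ hx hy =>
      obtain ⟨a, b, rfl⟩ := hx
      obtain ⟨c, d, rfl⟩ := hy
      exact ⟨a * c - b * d, a * d + b * c, by push_cast; linear_combination b * d * hi⟩
  have hnot (q : ℚ) : (q : F) ≠ i := fun h ↦ by
    rw [← h] at hi
    have : q ^ 2 = -1 := by exact_mod_cast hi
    nlinarith [sq_nonneg q]
  have h2' : 2 ∣ Module.finrank (IntermediateField.adjoin ℚ {i}) F := by
    rw [← natDegree_minpoly_sq (k := IntermediateField.adjoin ℚ {i}) (s := s) 61
      (by simpa [map_ofNat] using hs) ?_]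
    · exact minpoly.degree_dvd (IsIntegral.of_finite _ s)
    · rintro ⟨x, hx⟩ hxx
      have hxx : x ^ 2 = 61 := congrArg Subtype.val hxx
      obtain ⟨a, b, rfl⟩ := hform x hx
      have hab : a * b = 0 := by
        by_contra hab
        refine hnot ((61 - a ^ 2 + b ^ 2) / (2 * (a * b))) ?_
        have : (a * b : F) ≠ 0 := by exact_mod_cast hab
        push_cast
        rw [div_eq_iff (mul_ne_zero two_ne_zero this)]
        linear_combination -hxx + b ^ 2 * hi
      rcases mul_eq_zero.mp hab with rfl | rfl
      · have : -b ^ 2 = 61 := by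
          exact_mod_cast
            (by push_cast at hxx; linear_combination hxx - b ^ 2 * hi : -(b : F) ^ 2 = 61)
        nlinarith [sq_nonneg b]
      · exact sq_ne_sixty_one a (by
          exact_mod_cast (by push_cast at hxx; linear_combination hxx : (a : F) ^ 2 = 61))
  rw [← Module.finrank_mul_finrank ℚ (IntermediateField.adjoin ℚ {i}) F, h2]
  exact mul_dvd_mul_left 2 h2'

theorem exists_conjugate_roots {F : Type*} [Field F] [CharZero F] {i s b : F} (hi : i ^ 2 = -1)
    (hs : s ^ 2 = 61) (hb : b ^ 3 - b ^ 2 - 4 * b + 6 = 0) :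
    ∃ c d : F, b + c + d = 1 ∧ b * c + b * d + c * d = -4 ∧ b * c * d = -6 := by
  set t : F := i * s * (43 - 12 * b - 13 * b ^ 2) / 122 with ht
  have h4 : t ^ 2 = (17 + 2 * b - 3 * b ^ 2) / 4 := by
    rw [ht]
    linear_combination (s ^ 2 * (43 - 12 * b - 13 * b ^ 2) ^ 2 / 14884) * hi -
      ((43 - 12 * b - 13 * b ^ 2) ^ 2 / 14884) * hs - ((169 * b + 481) / 244) * hb
  have hsum : b * ((1 - b) / 2 + t) + b * ((1 - b) / 2 - t) +
      ((1 - b) / 2 + t) * ((1 - b) / 2 - t) = -4 := by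
    linear_combination -h4
  refine ⟨(1 - b) / 2 + t, (1 - b) / 2 - t, by ring, hsum, ?_⟩
  linear_combination b * hsum + hb

theorem exists_generators {F : Type*} [Field F] [CharZero F] {α : F}
    (h : α ^ 12 - 4 * α ^ 11 + 10 * α ^ 10 - 44 * α ^ 9 + 174 * α ^ 8 - 422 * α ^ 7 +
      618 * α ^ 6 - 512 * α ^ 5 + 170 * α ^ 4 + 56 * α ^ 3 - 58 * α ^ 2 + 6 * α + 9 = 0) :
    ∃ i s b : F, i ^ 2 = -1 ∧ s ^ 2 = 61 ∧ b ^ 3 - b ^ 2 - 4 * b + 6 = 0 := by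
  refine ⟨(5541 - 16718 * α - 20878 * α ^ 2 + 246907 * α ^ 3 - 466846 * α ^ 4 + 408524 * α ^ 5 -
      197983 * α ^ 6 + 50642 * α ^ 7 - 7750 * α ^ 8 + 4045 * α ^ 9 - 1518 * α ^ 10 -
      92 * α ^ 11) / 18042,
    (-14295 + 88857 * α - 284820 * α ^ 2 + 79511 * α ^ 3 + 1149890 * α ^ 4 - 2138439 * α ^ 5 +
      1813724 * α ^ 6 - 861093 * α ^ 7 + 227726 * α ^ 8 - 43563 * α ^ 9 + 19298 * α ^ 10 -
      6029 * α ^ 11) / 9021,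
    (6 - 3121 * α + 1783 * α ^ 2 + 8266 * α ^ 3 - 20993 * α ^ 4 + 25297 * α ^ 5 -
      17948 * α ^ 6 + 7861 * α ^ 7 - 2129 * α ^ 8 + 422 * α ^ 9 - 177 * α ^ 10 +
      51 * α ^ 11) / 582, ?_, ?_, ?_⟩
  · linear_combination (39579605 - 46971834 * α + 291729958 * α ^ 2 - 361878202 * α ^ 3 +
      222246410 * α ^ 4 - 64716128 * α ^ 5 + 4792473 * α ^ 6 - 2701580 * α ^ 7 +
      2728076 * α ^ 8 + 313168 * α ^ 9 + 8464 * α ^ 10) / 325513764 * h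
  · linear_combination (-528859764 + 70304106 * α - 1673013411 * α ^ 2 - 1017539508 * α ^ 3 +
      6379653812 * α ^ 4 - 7348609342 * α ^ 5 + 4194538645 * α ^ 6 - 1214899980 * α ^ 7 +
      185007368 * α ^ 8 - 87299920 * α ^ 9 + 36348841 * α ^ 10) / 81378441 * h
  · linear_combination (130519344 + 385219372 * α - 295883920 * α ^ 2 - 2063441553 * α ^ 3 +
      6606280507 * α ^ 4 - 6067300661 * α ^ 5 - 7177763692 * α ^ 6 + 31970137667 * α ^ 7 -
      55256891297 * α ^ 8 + 63307858623 * α ^ 9 - 53638021294 * α ^ 10 + 34965711262 * α ^ 11 -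
      17964064614 * α ^ 12 + 7480248468 * α ^ 13 - 2679972796 * α ^ 14 + 900420587 * α ^ 15 -
      289228761 * α ^ 16 + 80511615 * α ^ 17 - 17241930 * α ^ 18 + 3357585 * α ^ 19 -
      850527 * α ^ 20 + 132651 * α ^ 21) / 197137368 * h

theorem exists_generators_of_aeval_p12_eq_zero {F : Type*} [Field F] [CharZero F]
    [Algebra ℚ F] {α : F} (h : aeval α p12 = 0) :
    ∃ i s b : F, i ^ 2 = -1 ∧ s ^ 2 = 61 ∧ b ^ 3 - b ^ 2 - 4 * b + 6 = 0 := by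
  refine exists_generators (α := α) ?_
  simpa [p12, map_ofNat] using h

theorem irreducible_p12 : Irreducible p12 := by
  have hd : p12.natDegree = 12 := by
    unfold p12
    compute_degree!
  have hm : p12.Monic := by
    unfold p12
    monicity!
  obtain ⟨q, hqm, hqi, hq⟩ := exists_monic_irreducible_factor p12
    (not_isUnit_of_natDegree_pos _ (by omega))
  have : Fact (Irreducible q) := ⟨hqi⟩
  have : CharZero (AdjoinRoot q) := algebraRat.charZero _
  have : FiniteDimensional ℚ (AdjoinRoot q) := (AdjoinRoot.powerBasis hqi.ne_zero).finite
  have hrank : Module.finrank ℚ (AdjoinRoot q) = q.natDegree :=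
    (AdjoinRoot.powerBasis hqi.ne_zero).finrank
  obtain ⟨i, s, b, hi, hs, hb⟩ :=
    exists_generators_of_aeval_p12_eq_zero (α := AdjoinRoot.root q) (by
      rw [aeval_def, Subsingleton.elim (algebraMap ℚ (AdjoinRoot q)) (AdjoinRoot.of q)]
      exact eval₂_eq_zero_of_dvd_of_eval₂_eq_zero _ _ hq (AdjoinRoot.eval₂_root q))
  have h3 : 3 ∣ q.natDegree := by
    rw [← hrank, ← natDegree_minpoly_eq_three hb]
    exact minpoly.degree_dvd (IsIntegral.of_finite ℚ b)
  have h4 : 4 ∣ q.natDegree := hrank ▸ four_dvd_finrank hi hs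
  have hpos := hqi.natDegree_pos
  rwa [← eq_of_monic_of_dvd_of_natDegree_le hqm hm hq (by omega)] at hqi

theorem rank_eq_of_sq_eq_neg_one {K : Type*} [Field K] [NumberField K] {i : K}
    (hi : i ^ 2 = -1) : 2 * (Units.rank K + 1) = Module.finrank ℚ K := by
  have : IsTotallyComplex K := by
    refine ⟨fun v ↦ InfinitePlace.not_isReal_iff_isComplex.mp fun hv ↦ ?_⟩
    have h := congrArg (InfinitePlace.embedding_of_isReal hv) hi
    simp only [map_pow, map_neg, map_one] at h
    nlinarith [sq_nonneg (InfinitePlace.embedding_of_isReal hv i)]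
  have h := InfinitePlace.card_eq_nrRealPlaces_add_nrComplexPlaces K
  have := Fintype.card_pos (α := InfinitePlace K)
  rw [IsTotallyComplex.nrRealPlaces_eq_zero] at h
  rw [IsTotallyComplex.finrank, Units.rank]
  omega

theorem four_le_absNorm {K : Type*} [Field K] [NumberField K] (v : HeightOneSpectrum (𝓞 K))
    (h2 : 2 ∈ v.asIdeal) {w : 𝓞 K} (hw : w ^ 2 - w - 15 = 0) : 4 ≤ Ideal.absNorm v.asIdeal := by
  have hodd : (1 : 𝓞 K) ∉ v.asIdeal := fun h ↦ v.isPrime.ne_top ((Ideal.eq_top_iff_one _).mpr h)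
  have hmem := Ideal.absNorm_mem v.asIdeal
  have h0 := Ideal.absNorm_ne_zero_of_nonZeroDivisors
    ⟨v.asIdeal, mem_nonZeroDivisors_of_ne_zero v.ne_bot⟩
  by_contra! hlt
  simp only at h0
  interval_cases h : Ideal.absNorm v.asIdeal
  · exact h0 rfl
  · exact hodd (by simpa using hmem)
  · have := v.isMaximal
    let := Ideal.Quotient.field v.asIdeal
    have := Ideal.finiteQuotientOfFreeOfNeBot v.asIdeal v.ne_bot
    have := Fintype.ofFinite (𝓞 K ⧸ v.asIdeal)
    have hcard : Fintype.card (𝓞 K ⧸ v.asIdeal) = 2 := by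
      rw [← h, Ideal.absNorm_apply, Submodule.cardQuot_apply, Nat.card_eq_fintype_card]
    have hpow := FiniteField.pow_card (Ideal.Quotient.mk v.asIdeal w)
    rw [hcard, ← map_pow, Ideal.Quotient.eq] at hpow
    have h15 : (15 : 𝓞 K) ∈ v.asIdeal := by
      convert hpow using 1
      linear_combination -hw
    refine hodd ?_
    convert v.asIdeal.sub_mem h15 (v.asIdeal.mul_mem_left 7 h2) using 1
    norm_num
  · refine hodd ?_
    convert v.asIdeal.sub_mem hmem h2 using 1
    norm_num

theorem asIdeal_sq_dvd_span_two {K : Type*} [Field K] [NumberField K]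
    (v : HeightOneSpectrum (𝓞 K)) (h2 : 2 ∈ v.asIdeal) {i : 𝓞 K} (hi : i ^ 2 = -1) :
    v.asIdeal ^ 2 ∣ Ideal.span {2} := by
  rw [Ideal.dvd_span_singleton]
  have h1 : 1 + i ∈ v.asIdeal := v.isPrime.mem_of_pow_mem 2 (by
    convert v.asIdeal.mul_mem_right i h2 using 1
    linear_combination hi)
  convert Ideal.mul_mem_right (-i) _ (Ideal.pow_mem_pow h1 2) using 1
  linear_combination (2 + i) * hi

theorem finite_heightOneSpectrum_mem {R : Type*} [CommRing R] [IsDedekindDomain R] {a : R}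
    (ha : a ≠ 0) : Finite {v : HeightOneSpectrum R // a ∈ v.asIdeal} := by
  have h := Ideal.finite_factors (R := R) (I := Ideal.span {a}) (by simpa using ha)
  simp only [Ideal.dvd_span_singleton] at h
  exact h.to_subtype

theorem card_heightOneSpectrum_two_le {K : Type*} [Field K] [NumberField K] {i w : 𝓞 K}
    (hi : i ^ 2 = -1) (hw : w ^ 2 - w - 15 = 0) :
    4 * Nat.card {v : HeightOneSpectrum (𝓞 K) // 2 ∈ v.asIdeal} ≤ Module.finrank ℚ K := by
  have := finite_heightOneSpectrum_mem (two_ne_zero (α := 𝓞 K))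
  have := Fintype.ofFinite {v : HeightOneSpectrum (𝓞 K) // 2 ∈ v.asIdeal}
  rw [Nat.card_eq_fintype_card]
  have hdvd : ∏ v : {v : HeightOneSpectrum (𝓞 K) // 2 ∈ v.asIdeal}, v.1.asIdeal ^ 2 ∣
      Ideal.span {2} := by
    refine Finset.prod_dvd_of_coprime (fun v _ u _ hvu ↦ ?_)
      fun v _ ↦ asIdeal_sq_dvd_span_two v.1 v.2 hi
    refine IsCoprime.pow (Ideal.isCoprime_iff_sup_eq.mpr ?_)
    refine v.1.isMaximal.coprime_of_ne u.1.isMaximal fun h ↦ hvu ?_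
    exact Subtype.ext (HeightOneSpectrum.ext h)
  have hnorm := Ideal.absNorm_dvd_absNorm_of_le (Ideal.le_of_dvd hdvd)
  have h2 : Ideal.absNorm (Ideal.span {(2 : 𝓞 K)}) = 2 ^ Module.finrank ℚ K := by
    rw [Ideal.absNorm_span_singleton, ← RingOfIntegers.rank,
      show (2 : 𝓞 K) = algebraMap ℤ (𝓞 K) 2 by simp, Algebra.norm_algebraMap, Int.natAbs_pow]
    rfl
  rw [h2, map_prod] at hnorm
  have hle := Nat.le_of_dvd (by positivity) hnorm
  refine (Nat.pow_le_pow_iff_right one_lt_two).mp (le_trans ?_ hle)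
  rw [pow_mul, ← Finset.card_univ, ← Finset.prod_const]
  refine Finset.prod_le_prod' fun v _ ↦ ?_
  rw [map_pow]
  exact Nat.pow_le_pow_left (four_le_absNorm v.1 v.2 hw) 2

theorem exists_heightOneSpectrum_two_mem {K : Type*} [Field K] [NumberField K] {b : 𝓞 K}
    (hb : b ^ 3 - b ^ 2 - 4 * b + 6 = 0) :
    ∃ v : HeightOneSpectrum (𝓞 K), 2 ∈ v.asIdeal ∧ b - 1 ∈ v.asIdeal := by
  have hne : Ideal.span {2, b - 1} ≠ ⊤ := by
    intro htop
    obtain ⟨x, y, hxy⟩ := Ideal.mem_span_pair.mp ((Ideal.eq_top_iff_one _).mp htop)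
    set z : 𝓞 K := x * ((b - 1) ^ 2 + 2 * (b - 1) - 3) - y - (b - 1) + 2 with hz
    have h2z : 2 * z = (b - 1) ^ 2 + 1 := by
      rw [hz]
      linear_combination ((b - 1) ^ 2 + 2 * (b - 1) - 3) * hxy - y * hb
    refine not_isIntegral_of_cubic (w := (z : K)) ?_ (RingOfIntegers.isIntegral_coe z)
    have : 2 * z ^ 3 - 13 * z ^ 2 + 12 * z - 4 = 0 := by
      refine mul_left_cancel₀ (Nat.cast_ne_zero.mpr four_ne_zero : ((4 : ℕ) : 𝓞 K) ≠ 0) ?_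
      push_cast
      linear_combination ((2 * z) ^ 2 + 2 * z * ((b - 1) ^ 2 + 1) + ((b - 1) ^ 2 + 1) ^ 2 -
        13 * (2 * z + ((b - 1) ^ 2 + 1)) + 24) * h2z +
        ((b - 1) ^ 3 - 2 * (b - 1) ^ 2 - 3 * (b - 1) - 2) * hb
    simpa [map_ofNat] using congrArg (algebraMap (𝓞 K) K) this
  obtain ⟨m, hm, hle⟩ := Ideal.exists_le_maximal _ hne
  have h2 : 2 ∈ m := hle (Ideal.subset_span (by simp))
  refine ⟨⟨m, hm.isPrime, ?_⟩, h2, hle (Ideal.subset_span (by simp))⟩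
  rintro rfl
  exact two_ne_zero ((Submodule.mem_bot _).mp h2)

theorem not_two_mem_and_sub_one_mem {R : Type*} [CommRing R] {v : Ideal R} (hv : v ≠ ⊤)
    (h2 : 2 ∈ v) {b c d : R} (hsum : b + c + d = 1) (hprod : b * c * d = -6)
    (hb : b - 1 ∈ v) : c - 1 ∉ v := by
  intro hc
  refine hv ((Ideal.eq_top_iff_one _).mpr ?_)
  have hd : d + 1 ∈ v := by
    convert v.neg_mem (v.add_mem hb hc) using 1
    linear_combination hsum
  convert v.add_mem (v.add_mem (v.mul_mem_left 3 h2) (v.mul_mem_left (c * d) hb))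
    (v.add_mem (v.mul_mem_left d hc) hd) using 1
  linear_combination -hprod

theorem card_heightOneSpectrum_two {K : Type*} [Field K] [NumberField K]
    (hK : Module.finrank ℚ K = 12) {i s b : K} (hi : i ^ 2 = -1) (hs : s ^ 2 = 61)
    (hb : b ^ 3 - b ^ 2 - 4 * b + 6 = 0) :
    Nat.card {v : HeightOneSpectrum (𝓞 K) // 2 ∈ v.asIdeal} = 3 := by
  obtain ⟨c, d, h1, h2, h3⟩ := exists_conjugate_roots hi hs hb
  have lift_quad {x : K} (m n : ℤ) (hx : x ^ 2 + m * x + n = 0) :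
      ∃ y : 𝓞 K, (y : K) = x := by
    refine ⟨⟨x, X ^ 2 + C m * X + C n, by monicity!, ?_⟩, rfl⟩
    simpa only [eval₂_add, eval₂_mul, eval₂_X_pow, eval₂_X, eval₂_C, algebraMap_int_eq,
      Int.coe_castRingHom] using hx
  have lift_cubic {x : K} (hx : x ^ 3 - x ^ 2 - 4 * x + 6 = 0) : ∃ y : 𝓞 K, (y : K) = x := by
    refine ⟨⟨x, X ^ 3 - X ^ 2 - C 4 * X + C 6, by monicity!, ?_⟩, rfl⟩
    simpa [map_ofNat, eval₂_ofNat] using hx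
  obtain ⟨i, rfl⟩ := lift_quad (x := i) 0 1 (by push_cast; linear_combination hi)
  obtain ⟨w, hw⟩ := lift_quad (x := (1 + s) / 2) (-1) (-15)
    (by push_cast; linear_combination hs / 4)
  have hc : c ^ 3 - c ^ 2 - 4 * c + 6 = 0 := by
    linear_combination c ^ 2 * h1 - c * h2 + h3
  have hd : d ^ 3 - d ^ 2 - 4 * d + 6 = 0 := by
    linear_combination d ^ 2 * h1 - d * h2 + h3
  obtain ⟨b, rfl⟩ := lift_cubic hb
  obtain ⟨c, rfl⟩ := lift_cubic hc
  obtain ⟨d, rfl⟩ := lift_cubic hd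
  replace hw : w ^ 2 - w - 15 = 0 := by
    refine RingOfIntegers.ext ?_
    simp only [map_sub, map_pow, map_ofNat, map_zero, hw]
    linear_combination hs / 4
  replace hi : i ^ 2 = -1 := RingOfIntegers.ext (by simpa using hi)
  replace h1 : b + c + d = 1 := RingOfIntegers.ext (by simpa using h1)
  replace h3 : b * c * d = -6 := RingOfIntegers.ext (by simpa [map_ofNat] using h3)
  have hroot {x : 𝓞 K} (hx : (x : K) ^ 3 - (x : K) ^ 2 - 4 * x + 6 = 0) :
      x ^ 3 - x ^ 2 - 4 * x + 6 = 0 := RingOfIntegers.ext (by simpa [map_ofNat] using hx)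
  obtain ⟨u, hu, hbu⟩ := exists_heightOneSpectrum_two_mem (hroot hb)
  obtain ⟨v, hv, hcv⟩ := exists_heightOneSpectrum_two_mem (hroot hc)
  obtain ⟨v', hw2, hdv⟩ := exists_heightOneSpectrum_two_mem (hroot hd)
  refine le_antisymm (by have := card_heightOneSpectrum_two_le hi hw; omega) ?_
  have := finite_heightOneSpectrum_mem (two_ne_zero (α := 𝓞 K))
  have := Fintype.ofFinite {v : HeightOneSpectrum (𝓞 K) // 2 ∈ v.asIdeal}
  rw [Nat.card_eq_fintype_card]
  refine Fintype.two_lt_card_iff.mpr ⟨⟨u, hu⟩, ⟨v, hv⟩, ⟨v', hw2⟩, ?_, ?_, ?_⟩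
  · rintro ⟨⟩
    exact not_two_mem_and_sub_one_mem u.isPrime.ne_top hu h1 h3 hbu hcv
  · rintro ⟨⟩
    exact not_two_mem_and_sub_one_mem (d := c) u.isPrime.ne_top hu (by linear_combination h1)
      (by linear_combination h3) hbu hdv
  · rintro ⟨⟩
    exact not_two_mem_and_sub_one_mem (d := b) v.isPrime.ne_top hv (by linear_combination h1)
      (by linear_combination h3) hcv hdv

/-- `p₁₂` is irreducible over `ℚ`, and for the corresponding degree-12 number
field `L = ℚ[x]/(p₁₂)` with ring of integers `𝒪_L` and `R = 𝒪_L[1/2]`, the quotient of `Rˣ` by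
its subgroup of squares is isomorphic to `(ℤ/2ℤ)⁹`. -/
theorem stmt_15 :
    Irreducible p12 ∧
    ∀ (L : Type) [Field L] [NumberField L] (α : L),
      Polynomial.aeval α p12 = 0 → Module.finrank ℚ L = 12 →
      Nonempty
        ((Localization.Away (2 : 𝓞 L))ˣ ⧸
            (powMonoidHom 2 : (Localization.Away (2 : 𝓞 L))ˣ →*
              (Localization.Away (2 : 𝓞 L))ˣ).range
          ≃* Multiplicative (Fin 9 → ZMod 2)) := by
  refine ⟨irreducible_p12, fun L _ _ α hα hL ↦ ?_⟩
  obtain ⟨i, s, b, hi, hs, hb⟩ := exists_generators_of_aeval_p12_eq_zero hα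
  have h2 : (2 : 𝓞 L) ≠ 0 := two_ne_zero
  have := finite_heightOneSpectrum_mem h2
  obtain ⟨hfin, hrank⟩ := finite_and_finrank_units_localization_away L h2
  rw [card_heightOneSpectrum_two hL hi hs hb] at hrank
  have hle : Submonoid.powers (2 : 𝓞 L) ≤ nonZeroDivisors (𝓞 L) :=
    powers_le_nonZeroDivisors_of_noZeroDivisors h2
  have := IsLocalization.isDomain_of_le_nonZeroDivisors (Localization.Away (2 : 𝓞 L)) hle
  have : CharZero (Localization.Away (2 : 𝓞 L)) :=
    charZero_of_injective_algebraMap (IsLocalization.injective _ hle)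
  have h := nonempty_quotient_range_pow_two_mulEquiv (Localization.Away (2 : 𝓞 L))ˣ
    card_ker_powMonoidHom_two_units
  have hunits := rank_eq_of_sq_eq_neg_one hi
  rwa [show Module.finrank ℤ (Additive (Localization.Away (2 : 𝓞 L))ˣ) = 8 by omega] at h
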